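/- Fix k ≥ 1 and ε > 0, and let p : ℕ → [0,1] satisfy p(n) ≥ (2(k+1)(k+2)·log n)/n for all sufficiently large n. Then asymptotically almost surely a random complex Y ∈ Y_k(n, p(n)) satisfies h^k(Y) ≤ (1+ε)·p(n)·n/(k+2); that is, the probability that there exists a k-cochain β on Δ_n that is not a coboundary with ‖dβ‖_Y ≤ (1+ε)·p(n)·(n/(k+2))·‖[β]‖ tends to 1 as n → ∞. -/

import Mathlib

open scoped Classical

/-- The faces of the complete simplicial complex on vertex set `Fin n`,
indexed by cardinality: an element of `SFace n m` is an `m`-element subset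
of `{1, …, n}` (so a `(m-1)`-dimensional face). -/
abbrev SFace (n m : ℕ) : Type := {σ : Finset (Fin n) // σ.card = m}

/-- The norm of a `ZMod 2`-cochain: the size of its support. -/
def cnorm {X : Type} [Fintype X] (β : X → ZMod 2) : ℕ :=
  (Finset.univ.filter fun x => β x ≠ 0).card

/-- The simplicial coboundary map on the complete complex: for a cochain `β`
on `m`-element subsets, `sd β` evaluated on an `(m+1)`-element subset `τ` is
the sum of `β σ` over all `m`-element subsets `σ ⊆ τ`. -/
def sd {n m : ℕ} (β : SFace n m → ZMod 2) : SFace n (m + 1) → ZMod 2 :=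
  fun τ => ∑ σ : SFace n m, if σ.1 ⊆ τ.1 then β σ else 0

/-- A `k`-cochain is a coboundary if it is `dα` for some `(k-1)`-cochain `α`. -/
def IsCob {n k : ℕ} (β : SFace n (k + 1) → ZMod 2) : Prop :=
  ∃ α : SFace n k → ZMod 2, sd α = β

/-- The quotient norm `‖[β]‖ = min_α ‖β + dα‖` of a `k`-cochain. -/
noncomputable def qnorm {n k : ℕ} (β : SFace n (k + 1) → ZMod 2) : ℕ :=
  sInf {m | ∃ α : SFace n k → ZMod 2, m = cnorm (β + sd α)}

/-- Extension by zero of a cochain to all finite vertex sets. -/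
noncomputable def extendZero {n m : ℕ} (β : SFace n m → ZMod 2) (s : Finset (Fin n)) : ZMod 2 :=
  if h : s.card = m then β ⟨s, h⟩ else 0

theorem sd_eq_sum_erase {n m : ℕ} (β : SFace n m → ZMod 2) (τ : SFace n (m + 1)) :
    sd β τ = ∑ x ∈ τ.1, extendZero β (τ.1.erase x) := by
  unfold sd
  rw [← Finset.sum_filter]
  symm
  have hc : ∀ x ∈ τ.1, (τ.1.erase x).card = m := fun x hx => by
    rw [Finset.card_erase_of_mem hx, τ.2]; rfl
  refine Finset.sum_bij (fun x hx => (⟨τ.1.erase x, hc x hx⟩ : SFace n m)) ?_ ?_ ?_ ?_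
  · intro x hx
    simp [Finset.erase_subset]
  · intro x hx y hy h
    have h' : τ.1.erase x = τ.1.erase y := congrArg Subtype.val h
    exact Finset.erase_injOn τ.1 hx hy h'
  · intro σ hσ
    have hσ' : σ.1 ⊆ τ.1 := by simpa using hσ
    have h1 : (τ.1 \ σ.1).card = 1 := by
      rw [Finset.card_sdiff_of_subset hσ', τ.2, σ.2]; omega
    obtain ⟨x, hx⟩ := Finset.card_eq_one.mp h1
    have hxm : x ∈ τ.1 \ σ.1 := by rw [hx]; simp
    refine ⟨x, (Finset.mem_sdiff.mp hxm).1, Subtype.ext ?_⟩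
    change τ.1.erase x = σ.1
    rw [← Finset.sdiff_singleton_eq_erase, ← hx, Finset.sdiff_sdiff_eq_self hσ']
  · intro x hx
    rw [extendZero, dif_pos (hc x hx)]

theorem sd_sd {n m : ℕ} (α : SFace n m → ZMod 2) : sd (sd α) = 0 := by
  funext τ
  have hc : ∀ x ∈ τ.1, (τ.1.erase x).card = m + 1 := fun x hx => by
    rw [Finset.card_erase_of_mem hx, τ.2]; rfl
  rw [sd_eq_sum_erase]
  have h : ∀ x ∈ τ.1, extendZero (sd α) (τ.1.erase x) =
      ∑ y ∈ τ.1.erase x, extendZero α ((τ.1.erase x).erase y) := fun x hx => by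
    rw [extendZero, dif_pos (hc x hx), sd_eq_sum_erase]
  rw [Finset.sum_congr rfl h, Finset.sum_sigma']
  refine Finset.sum_involution (fun q _ => ⟨q.2, q.1⟩) ?_ ?_ ?_ ?_
  · rintro ⟨x, y⟩ -
    simp only [Finset.erase_right_comm (a := y) (b := x)]
    exact CharTwo.add_self_eq_zero _
  · rintro ⟨x, y⟩ hq - h
    simp only [Finset.mem_sigma, Finset.mem_erase] at hq
    simp only [Sigma.mk.injEq] at h
    exact hq.2.1 h.1
  · rintro ⟨x, y⟩ hq
    simp only [Finset.mem_sigma, Finset.mem_erase] at hq ⊢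
    exact ⟨hq.2.2, hq.2.1.symm, hq.1⟩
  · rintro ⟨x, y⟩ -
    rfl

theorem sd_add {n m : ℕ} (α β : SFace n m → ZMod 2) : sd (α + β) = sd α + sd β := by
  funext τ
  simp only [sd, Pi.add_apply, ← Finset.sum_add_distrib]
  exact Finset.sum_congr rfl fun σ _ => by split_ifs <;> simp

theorem cnorm_sd_le_mul_qnorm {n k M : ℕ} (β : SFace n (k + 1) → ZMod 2)
    (hM : ∀ σ : SFace n (k + 1),
      (Finset.univ.filter fun τ => σ.1 ⊆ τ.1 ∧ sd β τ ≠ 0).card ≤ M) :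
    cnorm (sd β) ≤ M * qnorm β := by
  obtain ⟨α, hα⟩ : ∃ α : SFace n k → ZMod 2, qnorm β = cnorm (β + sd α) :=
    Nat.sInf_mem (s := {m | ∃ α : SFace n k → ZMod 2, m = cnorm (β + sd α)}) ⟨_, 0, rfl⟩
  have hsd : sd (β + sd α) = sd β := by rw [sd_add, sd_sd, add_zero]
  rw [hα, mul_comm]
  refine (Finset.card_le_card ?_).trans (Finset.card_biUnion_le_card_mul
    (Finset.univ.filter fun σ => (β + sd α) σ ≠ 0)
    (fun σ => Finset.univ.filter fun τ => σ.1 ⊆ τ.1 ∧ sd β τ ≠ 0) M fun σ _ => hM σ)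
  intro τ hτ
  have hτ' : sd β τ ≠ 0 := by simpa using hτ
  have hne : sd (β + sd α) τ ≠ 0 := by rwa [hsd]
  obtain ⟨σ, -, hσ⟩ := Finset.exists_ne_zero_of_sum_ne_zero hne
  by_cases hsub : σ.1 ⊆ τ.1
  · rw [if_pos hsub] at hσ
    simp only [Finset.mem_biUnion, Finset.mem_filter, Finset.mem_univ, true_and]
    exact ⟨σ, hσ, hsub, hτ'⟩
  · exact absurd (if_neg hsub) hσ

/-- The indicator cochain of the sets which `c` maps bijectively onto all colours but the last. -/
noncomputable def colourCochain {n k : ℕ} (c : Fin n → Fin (k + 2)) :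
    SFace n (k + 1) → ZMod 2 :=
  fun σ => if σ.1.image c = Finset.univ.erase (Fin.last (k + 1)) then 1 else 0

theorem sd_colourCochain_ne_zero_iff {n k : ℕ} (c : Fin n → Fin (k + 2))
    (τ : SFace n (k + 2)) :
    sd (colourCochain c) τ ≠ 0 ↔ τ.1.image c = Finset.univ := by
  have hτ : τ.1.card = k + 2 := τ.2
  have hc : ∀ x ∈ τ.1, (τ.1.erase x).card = k + 1 := fun x hx => by
    rw [Finset.card_erase_of_mem hx, hτ]; rfl
  have hS : (Finset.univ.erase (Fin.last (k + 1))).card = k + 1 := by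
    rw [Finset.card_erase_of_mem (Finset.mem_univ _)]; simp
  set S := Finset.univ.erase (Fin.last (k + 1)) with hSdef
  have hsum : sd (colourCochain c) τ =
      ((τ.1.filter fun x => (τ.1.erase x).image c = S).card : ZMod 2) := by
    rw [sd_eq_sum_erase, Finset.card_filter, Nat.cast_sum]
    refine Finset.sum_congr rfl fun x hx => ?_
    rw [extendZero, dif_pos (hc x hx), colourCochain]
    split_ifs <;> simp
  have hinj : ∀ z ∈ τ.1, (τ.1.erase z).image c = S → Set.InjOn c (τ.1.erase z) := by
    intro z hz h
    rw [← Finset.card_image_iff, h, hS, hc z hz]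
  rw [hsum]
  constructor
  · intro h
    by_contra hne
    obtain ⟨z, hz⟩ : (τ.1.filter fun x => (τ.1.erase x).image c = S).Nonempty := by
      rw [Finset.nonempty_iff_ne_empty]
      rintro h0
      rw [h0] at h
      simp at h
    rw [Finset.mem_filter] at hz
    have hsub : S ⊆ τ.1.image c := by
      rw [← hz.2]; exact Finset.image_subset_image (Finset.erase_subset _ _)
    have himg : τ.1.image c = S := by
      refine le_antisymm (fun i hi => ?_) hsub
      rw [hSdef, Finset.mem_erase]
      refine ⟨?_, Finset.mem_univ _⟩
      rintro rfl
      refine hne (Finset.eq_univ_of_forall fun j => ?_)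
      by_cases hj : j = Fin.last (k + 1)
      · rwa [hj]
      · exact hsub (by simp [hSdef, hj])
    obtain ⟨x, hx, y, hy, hxy, hcxy⟩ := Finset.exists_ne_map_eq_of_card_lt_of_maps_to
      (s := τ.1) (t := S) (f := c) (by omega)
      (fun x hx => by rw [← himg]; exact Finset.mem_image_of_mem c hx)
    have herase : ∀ x y, x ∈ τ.1 → y ∈ τ.1 → x ≠ y → c x = c y →
        (τ.1.erase x).image c = S := by
      intro x y hx hy hxy hcxy
      rw [← himg]
      refine le_antisymm (Finset.image_subset_image (Finset.erase_subset _ _)) ?_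
      intro i hi
      obtain ⟨w, hw, rfl⟩ := Finset.mem_image.mp hi
      by_cases hwx : w = x
      · exact Finset.mem_image.mpr ⟨y, by simp [hxy.symm, hy], by rw [hwx, hcxy]⟩
      · exact Finset.mem_image_of_mem c (by simp [hwx, hw])
    have hpair : (τ.1.filter fun x => (τ.1.erase x).image c = S) = {x, y} := by
      ext w
      simp only [Finset.mem_filter, Finset.mem_insert, Finset.mem_singleton]
      constructor
      · rintro ⟨hw, hwS⟩
        by_contra! hcon
        exact hxy (hinj w hw hwS (by simp [hcon.1.symm, hx]) (by simp [hcon.2.symm, hy]) hcxy)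
      · rintro (rfl | rfl)
        · exact ⟨hx, herase _ _ hx hy hxy hcxy⟩
        · exact ⟨hy, herase _ _ hy hx hxy.symm hcxy.symm⟩
    rw [hpair, Finset.card_pair hxy] at h
    exact h rfl
  · intro himg
    have hinj : Set.InjOn c τ.1 := by
      rw [← Finset.card_image_iff, himg, hτ]; simp
    obtain ⟨x, hx, hcx⟩ :=
      Finset.mem_image.mp (himg.symm ▸ Finset.mem_univ (Fin.last (k + 1)))
    have hsingle : (τ.1.filter fun x => (τ.1.erase x).image c = S) = {x} := by
      ext w
      simp only [Finset.mem_filter, Finset.mem_singleton]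
      constructor
      · rintro ⟨hw, hwS⟩
        by_contra hwx
        have : c x ∈ S := by
          rw [← hwS]; exact Finset.mem_image_of_mem c (by simp [Ne.symm hwx, hx])
        simp [hSdef, hcx] at this
      · rintro rfl
        refine ⟨hx, ?_⟩
        ext i
        simp only [hSdef, Finset.mem_image, Finset.mem_erase, Finset.mem_univ, and_true]
        constructor
        · rintro ⟨v, ⟨hvw, hv⟩, rfl⟩ h
          exact hvw (hinj hv hx (h.trans hcx.symm))
        · intro hi
          obtain ⟨v, hv, rfl⟩ := Finset.mem_image.mp (himg.symm ▸ Finset.mem_univ i)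
          exact ⟨v, ⟨fun h => hi (h ▸ hcx), hv⟩, rfl⟩
    rw [hsingle]
    simp

theorem card_cofaces_colourCochain_le {n k M : ℕ} (c : Fin n → Fin (k + 2))
    (hM : ∀ i, (Finset.univ.filter fun x => c x = i).card ≤ M) (σ : SFace n (k + 1)) :
    (Finset.univ.filter fun τ => σ.1 ⊆ τ.1 ∧ sd (colourCochain c) τ ≠ 0).card ≤ M := by
  obtain ⟨i, hi⟩ : ∃ i, i ∉ σ.1.image c := by
    by_contra! h
    have := Finset.card_image_le (s := σ.1) (f := c)
    rw [Finset.eq_univ_of_forall h, σ.2] at this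
    simp at this
  rw [← Finset.card_image_of_injective _ Subtype.val_injective]
  refine (Finset.card_le_card (t := (Finset.univ.filter fun x => c x = i).image
    fun x => insert x σ.1) ?_).trans (Finset.card_image_le.trans (hM i))
  intro t ht
  simp only [Finset.mem_image, Finset.mem_filter, Finset.mem_univ, true_and] at ht ⊢
  obtain ⟨τ, ⟨hsub, hne⟩, rfl⟩ := ht
  rw [sd_colourCochain_ne_zero_iff] at hne
  obtain ⟨x, hx, hcx⟩ := Finset.mem_image.mp (hne.symm ▸ Finset.mem_univ i)
  have hxσ : x ∉ σ.1 := fun h => hi (hcx ▸ Finset.mem_image_of_mem c h)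
  refine ⟨x, hcx, Finset.eq_of_subset_of_card_le (Finset.insert_subset hx hsub) ?_⟩
  rw [Finset.card_insert_of_notMem hxσ, τ.2, σ.2]

theorem pow_le_cnorm_sd_colourCochain {n k m : ℕ} (c : Fin n → Fin (k + 2))
    (v : Fin (k + 2) → Fin m → Fin n) (hv : ∀ i, Function.Injective (v i))
    (hc : ∀ i j, c (v i j) = i) :
    m ^ (k + 2) ≤ cnorm (sd (colourCochain c)) := by
  have himg : ∀ g : Fin (k + 2) → Fin m,
      (Finset.univ.image fun i => v i (g i)).image c = Finset.univ := by
    intro g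
    refine Finset.eq_univ_of_forall fun i => ?_
    simp only [Finset.mem_image, Finset.mem_univ, true_and, exists_exists_eq_and]
    exact ⟨i, hc i (g i)⟩
  have hcard : ∀ g : Fin (k + 2) → Fin m,
      (Finset.univ.image fun i => v i (g i)).card = k + 2 := by
    intro g
    rw [Finset.card_image_of_injective, Finset.card_univ, Fintype.card_fin]
    intro i j h
    have := congrArg c h
    rwa [hc, hc] at this
  have hle : (Finset.univ : Finset (Fin (k + 2) → Fin m)).card ≤
      cnorm (sd (colourCochain c)) := by
    refine Finset.card_le_card_of_injOn (fun g => ⟨_, hcard g⟩) ?_ ?_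
    · intro g _
      simp only [Finset.coe_filter, Finset.mem_univ, true_and, Set.mem_ofPred_eq]
      exact (sd_colourCochain_ne_zero_iff c _).mpr (himg g)
    · intro g _ g' _ h
      have h' : (Finset.univ.image fun i => v i (g i)) =
        Finset.univ.image fun i => v i (g' i) := congrArg Subtype.val h
      funext i
      have hi : v i (g i) ∈ Finset.univ.image fun i => v i (g' i) :=
        h' ▸ Finset.mem_image_of_mem _ (Finset.mem_univ i)
      obtain ⟨j, -, hj⟩ := Finset.mem_image.mp hi
      have hij := congrArg c hj
      rw [hc, hc] at hij
      subst hij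
      exact (hv j hj).symm
  simpa using hle

theorem exists_cochain_cnorm_sd_le (n k : ℕ) :
    ∃ β : SFace n (k + 1) → ZMod 2,
      cnorm (sd β) ≤ (n / (k + 2) + 1) * qnorm β ∧ (n / (k + 2)) ^ (k + 2) ≤ cnorm (sd β) := by
  let c : Fin n → Fin (k + 2) := fun x => ⟨x.1 % (k + 2), Nat.mod_lt _ (by omega)⟩
  have hvlt : ∀ (i : Fin (k + 2)) (j : Fin (n / (k + 2))), i.1 + (k + 2) * j.1 < n := by
    intro i j
    have h1 : (k + 2) * (j.1 + 1) ≤ (k + 2) * (n / (k + 2)) := Nat.mul_le_mul_left _ j.2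
    have h2 := Nat.mul_div_le n (k + 2)
    have := i.2
    rw [mul_add] at h1
    omega
  refine ⟨colourCochain c, ?_, ?_⟩
  · refine cnorm_sd_le_mul_qnorm _ (card_cofaces_colourCochain_le c fun i => ?_)
    rw [← Finset.card_range (n / (k + 2) + 1)]
    refine Finset.card_le_card_of_injOn (fun x => x.1 / (k + 2)) ?_ ?_
    · intro x _
      simp only [Finset.coe_range, Set.mem_Iio]
      exact Nat.lt_succ_of_le (Nat.div_le_div_right x.2.le)
    · intro x hx y hy h
      simp only [Finset.coe_filter, Finset.mem_univ, true_and, Set.mem_ofPred_eq] at hx hy h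
      have hxy : x.1 % (k + 2) = y.1 % (k + 2) := congrArg Fin.val (hx.trans hy.symm)
      ext
      rw [← Nat.div_add_mod x.1 (k + 2), ← Nat.div_add_mod y.1 (k + 2), h, hxy]
  · refine pow_le_cnorm_sd_colourCochain c (fun i j => ⟨i.1 + (k + 2) * j.1, hvlt i j⟩) ?_ ?_
    · intro i j j' h
      have h' := congrArg Fin.val h
      simp only [Nat.add_left_cancel_iff] at h'
      exact Fin.ext (Nat.eq_of_mul_eq_mul_left (by omega) h')
    · intro i j
      ext
      simp [c, Nat.add_mul_mod_self_left, Nat.mod_eq_of_lt i.2]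

/-- The weight of `Y` under the product Bernoulli measure with parameter `q`. -/
noncomputable def bernoulliWeight {X : Type} [Fintype X] (q : ℝ) (Y : Finset X) : ℝ :=
  q ^ Y.card * (1 - q) ^ (Fintype.card X - Y.card)

theorem bernoulliWeight_nonneg {X : Type} [Fintype X] {q : ℝ} (h0 : 0 ≤ q) (h1 : q ≤ 1)
    (Y : Finset X) : 0 ≤ bernoulliWeight q Y :=
  mul_nonneg (pow_nonneg h0 _) (pow_nonneg (sub_nonneg.mpr h1) _)

theorem sum_bernoulliWeight_mul_pow {X : Type} [Fintype X] (q t : ℝ) (P : X → Prop)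
    [DecidablePred P] :
    ∑ Y : Finset X, bernoulliWeight q Y * t ^ (Y.filter P).card =
      (1 - q + q * t) ^ (Finset.univ.filter P).card := by
  have h := Finset.prod_add (fun x : X => q * if P x then t else 1) (fun _ => 1 - q) Finset.univ
  rw [Finset.powerset_univ] at h
  have hl : ∏ x : X, ((q * if P x then t else 1) + (1 - q)) =
      (1 - q + q * t) ^ (Finset.univ.filter P).card := by
    rw [← Finset.prod_const, Finset.prod_filter]
    refine Finset.prod_congr rfl fun x _ => ?_
    split_ifs <;> ring
  rw [← hl, h]
  refine Finset.sum_congr rfl fun Y _ => ?_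
  rw [Finset.prod_mul_distrib, Finset.prod_const, Finset.prod_const, ← Finset.prod_filter,
    Finset.prod_const, ← Finset.compl_eq_univ_sdiff, Finset.card_compl, bernoulliWeight]
  ring

theorem sum_bernoulliWeight {X : Type} [Fintype X] (q : ℝ) :
    ∑ Y : Finset X, bernoulliWeight q Y = 1 := by
  simpa using sum_bernoulliWeight_mul_pow (X := X) q 1 fun _ => True

/-- The multiplicative Chernoff bound for the upper tail of a binomial variable. -/
theorem sum_bernoulliWeight_tail_le {X : Type} [Fintype X] {q δ : ℝ} (h0 : 0 ≤ q) (h1 : q ≤ 1)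
    (hδ : 0 < δ) (P : X → Prop)
    [DecidablePred P] :
    (∑ Y : Finset X, if ((Y.filter P).card : ℝ) ≤ (1 + δ) * q * (Finset.univ.filter P).card
      then 0 else bernoulliWeight q Y) ≤
      Real.exp (-(((1 + δ) * Real.log (1 + δ) - δ) * (q * (Finset.univ.filter P).card))) := by
  set T : ℝ := ((Finset.univ.filter P).card : ℝ) with hT
  have hpos : 0 < 1 + δ := by linarith
  have hlog : 0 ≤ Real.log (1 + δ) := Real.log_nonneg (by linarith)
  have hterm : ∀ Y : Finset X, (if ((Y.filter P).card : ℝ) ≤ (1 + δ) * q * T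
      then 0 else bernoulliWeight q Y) ≤
      Real.exp (-((1 + δ) * q * T * Real.log (1 + δ))) *
        (bernoulliWeight q Y * (1 + δ) ^ (Y.filter P).card) := by
    intro Y
    have hw := bernoulliWeight_nonneg h0 h1 Y
    split_ifs with h
    · positivity
    · have hpow : (1 + δ) ^ (Y.filter P).card =
          Real.exp ((Y.filter P).card * Real.log (1 + δ)) := by
        rw [Real.exp_nat_mul, Real.exp_log hpos]
      rw [mul_left_comm, hpow, ← Real.exp_add]
      refine le_mul_of_one_le_right hw (Real.one_le_exp ?_)
      nlinarith [mul_le_mul_of_nonneg_right (not_le.mp h).le hlog]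
  refine (Finset.sum_le_sum fun Y _ => hterm Y).trans ?_
  rw [← Finset.mul_sum, sum_bernoulliWeight_mul_pow]
  have hb : (1 - q + q * (1 + δ)) ^ (Finset.univ.filter P).card ≤ Real.exp (T * (q * δ)) := by
    rw [Real.exp_nat_mul]
    refine pow_le_pow_left₀ (by nlinarith) ?_ _
    linarith [Real.add_one_le_exp (q * δ)]
  refine (mul_le_mul_of_nonneg_left hb (Real.exp_nonneg _)).trans ?_
  rw [← Real.exp_add]
  exact Real.exp_le_exp.mpr (by ring_nf; rfl)

theorem lt_one_add_mul_log_one_add {δ : ℝ} (hδ : 0 < δ) : δ < (1 + δ) * Real.log (1 + δ) := by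
  have hpos : 0 < 1 + δ := by linarith
  have h := Real.log_lt_sub_one_of_pos (inv_pos.mpr hpos) (by
    intro h
    rw [inv_eq_one] at h
    linarith)
  rw [Real.log_inv] at h
  have h2 := mul_lt_mul_of_pos_left h hpos
  rw [mul_sub, mul_inv_cancel₀ hpos.ne'] at h2
  linarith

theorem not_isCob_of_cnorm_sd_pos {n k : ℕ} {β : SFace n (k + 1) → ZMod 2}
    (h : 0 < cnorm (sd β)) : ¬ IsCob β := by
  rintro ⟨α, rfl⟩
  rw [sd_sd] at h
  simp [cnorm] at h

theorem le_div_pow {n k : ℕ} (h : 2 * (k + 2) ^ 2 ≤ n) : n ≤ (n / (k + 2)) ^ (k + 2) := by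
  have hm : 2 * (k + 2) ≤ n / (k + 2) := by
    rw [Nat.le_div_iff_mul_le (by omega)]
    nlinarith
  have hn := Nat.lt_mul_div_succ n (show 0 < k + 2 by omega)
  calc n ≤ (n / (k + 2)) ^ 2 := by nlinarith
    _ ≤ _ := Nat.pow_le_pow_right (by omega) (by omega)

/-- the upper bound on the expansion of the Linial–Meshulam
random complex `Y ∈ Y_k(n, p(n))`. Fix `k ≥ 1`, `ε > 0` and suppose
`p(n) ≥ 2(k+1)(k+2)·log n/n` for all sufficiently large `n`. Then the
probability (a weighted sum over all sets `Y` of `(k+1)`-faces, each kept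
independently with probability `p(n)`) of the event that some non-coboundary
`k`-cochain `β` satisfies `‖dβ‖_Y ≤ (1+ε)·p(n)·(n/(k+2))·‖[β]‖` — i.e. that
`h^k(Y) ≤ (1+ε)·p(n)·n/(k+2)` — tends to `1` as `n → ∞`. -/
theorem linial_meshulam_expansion_upper (k : ℕ) (hk : 1 ≤ k) (ε : ℝ) (hε : 0 < ε)
    (p : ℕ → ℝ) (hp0 : ∀ n, 0 ≤ p n) (hp1 : ∀ n, p n ≤ 1)
    (hp : ∀ᶠ n : ℕ in Filter.atTop,
      p n ≥ 2 * ((k : ℝ) + 1) * ((k : ℝ) + 2) * Real.log n / (n : ℝ)) :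
    Filter.Tendsto
      (fun n : ℕ => ∑ Y : Finset (SFace n (k + 2)),
        if ∃ β : SFace n (k + 1) → ZMod 2, ¬ IsCob β ∧
            ((Y.filter fun τ => sd β τ ≠ 0).card : ℝ) ≤
              (1 + ε) * p n * ((n : ℝ) / ((k : ℝ) + 2)) * (qnorm β : ℝ)
          then p n ^ Y.card * (1 - p n) ^ (Fintype.card (SFace n (k + 2)) - Y.card) else 0)
      Filter.atTop (nhds 1) := by
  set a : ℝ := (1 + ε / 2) * Real.log (1 + ε / 2) - ε / 2 with ha
  have ha0 : 0 < a := sub_pos.mpr (lt_one_add_mul_log_one_add (half_pos hε))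
  have hK : (0 : ℝ) < (k : ℝ) + 2 := by positivity
  set C : ℝ := 2 * ((k : ℝ) + 1) * ((k : ℝ) + 2) with hC
  have hC0 : 0 < C := by positivity
  have hlim : Filter.Tendsto (fun n : ℕ => 1 - Real.exp (-(a * (C * Real.log n))))
      Filter.atTop (nhds 1) := by
    have h1 : Filter.Tendsto (fun n : ℕ => a * (C * Real.log n)) Filter.atTop Filter.atTop :=
      ((Real.tendsto_log_atTop.comp tendsto_natCast_atTop_atTop).const_mul_atTop
        hC0).const_mul_atTop ha0
    simpa using (Real.tendsto_exp_neg_atTop_nhds_zero.comp h1).const_sub 1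
  refine tendsto_of_tendsto_of_tendsto_of_le_of_le' hlim tendsto_const_nhds ?_ ?_
  · filter_upwards [hp, Filter.eventually_ge_atTop (2 * (k + 2) ^ 2),
      (tendsto_natCast_atTop_atTop (R := ℝ)).eventually_ge_atTop
        ((1 + ε / 2) * ((k : ℝ) + 2) / (ε / 2))] with n hpn hn hnε
    obtain ⟨β, hβ, hT⟩ := exists_cochain_cnorm_sd_le n k
    have hnT : n ≤ cnorm (sd β) := (le_div_pow hn).trans hT
    have hn0 : 0 < n := lt_of_lt_of_le (by positivity) hn
    have hn0' : (0 : ℝ) < n := by exact_mod_cast hn0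
    have hcob : ¬ IsCob β := not_isCob_of_cnorm_sd_pos (hn0.trans_le hnT)
    have hβ' : (cnorm (sd β) : ℝ) ≤ ((n : ℝ) / ((k : ℝ) + 2) + 1) * qnorm β := by
      have h1 : ((n / (k + 2) : ℕ) : ℝ) ≤ (n : ℝ) / ((k : ℝ) + 2) := by
        simpa using Nat.cast_div_le (α := ℝ) (m := n) (n := k + 2)
      calc (cnorm (sd β) : ℝ) ≤ (((n / (k + 2) : ℕ) : ℝ) + 1) * qnorm β := by exact_mod_cast hβ
        _ ≤ _ := by gcongr
    have hfac : (1 + ε / 2) * ((n : ℝ) / ((k : ℝ) + 2) + 1) ≤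
        (1 + ε) * ((n : ℝ) / ((k : ℝ) + 2)) := by
      have h1 : (1 + ε / 2) ≤ (ε / 2) * ((n : ℝ) / ((k : ℝ) + 2)) := by
        rw [div_le_iff₀ (half_pos hε)] at hnε
        rw [mul_div_assoc', le_div_iff₀ hK]
        linarith
      linarith
    have hdet : (1 + ε / 2) * p n * cnorm (sd β) ≤
        (1 + ε) * p n * ((n : ℝ) / ((k : ℝ) + 2)) * (qnorm β : ℝ) := by
      calc (1 + ε / 2) * p n * cnorm (sd β)
          ≤ (1 + ε / 2) * p n * (((n : ℝ) / ((k : ℝ) + 2) + 1) * qnorm β) :=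
            mul_le_mul_of_nonneg_left hβ' (mul_nonneg (by linarith) (hp0 n))
        _ = ((1 + ε / 2) * ((n : ℝ) / ((k : ℝ) + 2) + 1)) * (p n * qnorm β) := by ring
        _ ≤ ((1 + ε) * ((n : ℝ) / ((k : ℝ) + 2))) * (p n * qnorm β) :=
            mul_le_mul_of_nonneg_right hfac (mul_nonneg (hp0 n) (Nat.cast_nonneg _))
        _ = _ := by ring
    have htail := sum_bernoulliWeight_tail_le (hp0 n) (hp1 n) (half_pos hε)
      fun τ : SFace n (k + 2) => sd β τ ≠ 0
    have hpT : C * Real.log n ≤ p n * cnorm (sd β) := by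
      rw [ge_iff_le, div_le_iff₀ hn0'] at hpn
      exact hpn.trans (mul_le_mul_of_nonneg_left (by exact_mod_cast hnT) (hp0 n))
    rw [← ha, show (Finset.univ.filter fun τ : SFace n (k + 2) => sd β τ ≠ 0).card =
      cnorm (sd β) from rfl] at htail
    have hexp : Real.exp (-(a * (p n * cnorm (sd β)))) ≤ Real.exp (-(a * (C * Real.log n))) :=
      Real.exp_le_exp.mpr (neg_le_neg (mul_le_mul_of_nonneg_left hpT ha0.le))
    refine (sub_le_sub_left (htail.trans hexp) 1).trans ?_
    rw [sub_le_iff_le_add]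
    refine (sum_bernoulliWeight (X := SFace n (k + 2)) (p n)).ge.trans ?_
    rw [← Finset.sum_add_distrib]
    refine Finset.sum_le_sum fun Y _ => ?_
    have hw := bernoulliWeight_nonneg (hp0 n) (hp1 n) Y
    split_ifs with h1 h2 h2
    · exact (add_zero _).ge
    · exact le_add_of_nonneg_left hw
    · exact absurd ⟨β, hcob, h2.trans hdet⟩ h1
    · exact (zero_add _).ge
  · filter_upwards with n
    refine (Finset.sum_le_sum fun Y _ => ?_).trans
      (sum_bernoulliWeight (X := SFace n (k + 2)) (p n)).le
    split_ifs
    · exact le_rfl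
    · exact bernoulliWeight_nonneg (hp0 n) (hp1 n) Y
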